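/- Let n ≥ 2. For 1 ≤ i ≤ n−1 let B_i be the n×n diagonal real matrix whose (i,i) entry is 1 and whose other diagonal entries are −1, let b_i ∈ ℝ^n have i-th coordinate equal to 1/2, and let β_i be the affine transformation v ↦ B_i v + b_i of ℝ^n. Let Φ : G_{n−1} → (affine transformations of ℝ^n) be the homomorphism with Φ(x_i) = β_i. Then ker Φ is a free group. -/

import Mathlib

/-- Relators of the combinatorial generalized Hantzsche-Wendt group:
`x_i⁻¹ x_j² x_i x_j²` for all `i ≠ j`. -/
def HWrels (n : ℕ) : Set (FreeGroup (Fin n)) :=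
  {r | ∃ i j : Fin n, i ≠ j ∧
    r = (FreeGroup.of i)⁻¹ * (FreeGroup.of j) ^ 2 * FreeGroup.of i * (FreeGroup.of j) ^ 2}

/-- The combinatorial generalized Hantzsche-Wendt group `G_n`. -/
abbrev GHW (n : ℕ) : Type := PresentedGroup (HWrels n)

/-- The generator `x_i` of `G_n`. -/
def ghw {n : ℕ} (i : Fin n) : GHW n := PresentedGroup.of i

noncomputable def hwInv (m : ℕ) : ℤˣ →* MulAut (FreeGroup (Fin m)) where
  toFun u := MonoidHom.toMulEquiv
    (FreeGroup.lift (fun i => (FreeGroup.of i : FreeGroup (Fin m)) ^ ((u : ℤˣ) : ℤ)))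
    (FreeGroup.lift (fun i => (FreeGroup.of i : FreeGroup (Fin m)) ^ ((u : ℤˣ) : ℤ)))
    (by
      ext i
      simp only [MonoidHom.comp_apply, FreeGroup.lift_apply_of, map_zpow, ← zpow_mul,
        MonoidHom.id_apply]
      rcases Int.units_eq_one_or u with rfl | rfl <;> simp)
    (by
      ext i
      simp only [MonoidHom.comp_apply, FreeGroup.lift_apply_of, map_zpow, ← zpow_mul,
        MonoidHom.id_apply]
      rcases Int.units_eq_one_or u with rfl | rfl <;> simp)
  map_one' := by
    apply MulEquiv.toMonoidHom_injective
    ext i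
    simp
  map_mul' u v := by
    apply MulEquiv.toMonoidHom_injective
    ext i
    simp [zpow_mul]

theorem hwInv_of (m : ℕ) (u : ℤˣ) (i : Fin m) :
    hwInv m u (FreeGroup.of i) = FreeGroup.of i ^ (u : ℤ) := by
  simp [hwInv]

theorem ghw_rel {m : ℕ} {i j : Fin m} (h : i ≠ j) :
    (ghw i)⁻¹ * (ghw j) ^ 2 * ghw i * (ghw j) ^ 2 = 1 := by
  have : PresentedGroup.mk (HWrels m) ((FreeGroup.of i)⁻¹ * (FreeGroup.of j) ^ 2 *
      FreeGroup.of i * (FreeGroup.of j) ^ 2) = 1 :=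
    PresentedGroup.one_of_mem ⟨i, j, h, rfl⟩
  simp only [map_mul, map_inv, map_pow] at this
  exact this

theorem ghw_induction {m : ℕ} {p : GHW m → Prop} (h1 : p 1) (hg : ∀ i, p (ghw i))
    (hm : ∀ a b, p a → p b → p (a * b)) (hi : ∀ a, p a → p a⁻¹) (g : GHW m) : p g := by
  have hmem : g ∈ Subgroup.closure (Set.range (PresentedGroup.of (rels := HWrels m))) := by
    rw [PresentedGroup.closure_range_of]; trivial
  induction hmem using Subgroup.closure_induction with
  | mem x hx => obtain ⟨i, rfl⟩ := hx; exact hg i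
  | one => exact h1
  | mul x y _ _ hx hy => exact hm x y hx hy
  | inv x _ hx => exact hi x hx

theorem ghw_conj {m : ℕ} (g : GHW m) (j : Fin m) :
    g * (ghw j) ^ 2 * g⁻¹ = (ghw j) ^ 2 ∨ g * (ghw j) ^ 2 * g⁻¹ = ((ghw j) ^ 2)⁻¹ := by
  induction g using ghw_induction with
  | h1 => left; simp
  | hg i =>
    by_cases h : i = j
    · subst h; left; group
    · right
      have h1 := ghw_rel h
      have h2 : (ghw i)⁻¹ * (ghw j) ^ 2 * ghw i = ((ghw j) ^ 2)⁻¹ := eq_inv_of_mul_eq_one_left h1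
      clear h1
      generalize (ghw j) ^ 2 = y at *
      generalize ghw i = x at *
      have h3 : y = x * (x⁻¹ * y * x) * x⁻¹ := by group
      rw [h2] at h3
      calc x * y * x⁻¹ = (x * y⁻¹ * x⁻¹)⁻¹ := by group
        _ = y⁻¹ := by rw [← h3]
  | hm a b ha hb =>
    generalize (ghw j) ^ 2 = y at *
    have : a * b * y * (a * b)⁻¹ = a * (b * y * b⁻¹) * a⁻¹ := by group
    rw [this]
    rcases hb with hb | hb
    · rw [hb]; exact ha
    · rw [hb]
      have : a * y⁻¹ * a⁻¹ = (a * y * a⁻¹)⁻¹ := by group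
      rw [this]
      rcases ha with ha | ha <;> rw [ha] <;> simp
  | hi a ha =>
    generalize (ghw j) ^ 2 = y at *
    rcases ha with ha | ha
    · left
      nth_rewrite 1 [← ha]; group
    · right
      have : y = (a * y * a⁻¹)⁻¹ := by rw [ha, inv_inv]
      nth_rewrite 1 [this]; group

def hwA (m : ℕ) : Subgroup (GHW m) := Subgroup.closure (Set.range fun i => (ghw i) ^ 2)

theorem hwA_sq {m : ℕ} (i : Fin m) : (ghw i) ^ 2 ∈ hwA m :=
  Subgroup.subset_closure ⟨i, rfl⟩

instance hwA_normal (m : ℕ) : (hwA m).Normal where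
  conj_mem a ha g := by
    unfold hwA at ha
    induction ha using Subgroup.closure_induction with
    | mem x hx =>
      obtain ⟨i, rfl⟩ := hx
      rcases ghw_conj g i with h | h
      · simp only [h]; exact hwA_sq i
      · simp only [h]; exact inv_mem (hwA_sq i)
    | one => simp
    | mul x y _ _ hx hy =>
      have := mul_mem hx hy
      rwa [conj_mul] at this
    | inv x _ hx =>
      have := inv_mem hx
      rwa [conj_inv] at this

theorem ghw_comm {m : ℕ} (i j : Fin m) : Commute ((ghw i) ^ 2) ((ghw j) ^ 2) := by
  have key : ∀ z : GHW m, z ^ 2 * (ghw j) ^ 2 * (z ^ 2)⁻¹ = z * (z * (ghw j) ^ 2 * z⁻¹) * z⁻¹ := by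
    intro z; simp only [pow_two, mul_inv_rev, mul_assoc]
  have : (ghw i) ^ 2 * (ghw j) ^ 2 * ((ghw i) ^ 2)⁻¹ = (ghw j) ^ 2 := by
    rw [key]
    rcases ghw_conj (ghw i) j with h | h
    · rw [h, h]
    · rw [h, ← conj_inv, h, inv_inv]
  exact mul_inv_eq_iff_eq_mul.mp this

noncomputable def hwP (m : ℕ) : (Fin m → Multiplicative ℤ) →* GHW m :=
  MonoidHom.noncommPiCoprod (fun i => zpowersHom (GHW m) ((ghw i) ^ 2))
    (by
      intro i j _ x y
      simp only [zpowersHom_apply]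
      exact (ghw_comm i j).zpow_zpow _ _)

theorem hwP_single (m : ℕ) (i : Fin m) :
    hwP m (Pi.mulSingle i (Multiplicative.ofAdd 1)) = (ghw i) ^ 2 := by
  refine (MonoidHom.noncommPiCoprod_mulSingle (N := fun _ : Fin m => Multiplicative ℤ)
    (ϕ := fun i => zpowersHom (GHW m) ((ghw i) ^ 2)) i (Multiplicative.ofAdd (1 : ℤ))).trans ?_
  simp [zpowersHom_apply]

noncomputable def hwTheta (m : ℕ) : GHW m →* FreeGroup (Fin m) ⋊[hwInv m] ℤˣ :=
  PresentedGroup.toGroup (f := fun i => ⟨FreeGroup.of i, -1⟩) (by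
    rintro r ⟨i, j, _, rfl⟩
    have h : ∀ i : Fin m, (⟨FreeGroup.of i, -1⟩ : FreeGroup (Fin m) ⋊[hwInv m] ℤˣ) ^ 2 = 1 := by
      intro i
      rw [pow_two]
      ext <;> simp [hwInv_of]
    simp only [map_mul, map_inv, map_pow, FreeGroup.lift_apply_of, h]
    simp)

theorem hwTheta_ghw (m : ℕ) (i : Fin m) : hwTheta m (ghw i) = ⟨FreeGroup.of i, -1⟩ := by
  simp [hwTheta, ghw]

theorem hwTheta_ker (m : ℕ) (hm : 1 ≤ m) (g : GHW m) (hg : hwTheta m g = 1) : g ∈ hwA m := by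
  let q : GHW m →* GHW m ⧸ hwA m := QuotientGroup.mk' _
  let z : Fin m := ⟨0, hm⟩
  have hq : ∀ i, q (ghw i) * q (ghw i) = 1 := by
    intro i
    rw [← map_mul, ← pow_two]
    exact (QuotientGroup.eq_one_iff _).mpr (hwA_sq i)
  have hqi : ∀ i, (q (ghw i))⁻¹ = q (ghw i) := fun i => inv_eq_of_mul_eq_one_left (hq i)
  let f1 : FreeGroup (Fin m) →* GHW m ⧸ hwA m := FreeGroup.lift fun i => q (ghw i) * q (ghw z)
  let f2 : ℤˣ →* GHW m ⧸ hwA m :=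
    { toFun := fun u => if u = 1 then 1 else q (ghw z)
      map_one' := by simp
      map_mul' := by
        intro u v
        rcases Int.units_eq_one_or u with rfl | rfl <;>
        rcases Int.units_eq_one_or v with rfl | rfl <;> simp [hq] }
  have hf2 : f2 (-1) = q (ghw z) := by
    change (if (-1 : ℤˣ) = 1 then 1 else q (ghw z)) = _
    simp
  let ψ : FreeGroup (Fin m) ⋊[hwInv m] ℤˣ →* GHW m ⧸ hwA m := SemidirectProduct.lift f1 f2 (by
    intro u
    ext i
    rcases Int.units_eq_one_or u with rfl | rfl
    · simp
    · simp only [MonoidHom.comp_apply, MulEquiv.coe_toMonoidHom, hwInv_of, hf2, MulAut.conj_apply,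
        map_zpow, f1, FreeGroup.lift_apply_of]
      simp [hqi, mul_assoc, hq])
  have hψ : ∀ g, ψ (hwTheta m g) = q g := by
    intro g
    induction g using ghw_induction with
    | h1 => simp
    | hg i =>
      rw [hwTheta_ghw]
      change f1 (FreeGroup.of i) * f2 (-1) = _
      rw [hf2]
      simp [f1, mul_assoc, hq]
    | hm a b ha hb => simp only [map_mul, ha, hb]
    | hi a ha => simp only [map_inv, ha]
  have := hψ g
  rw [hg, map_one] at this
  exact (QuotientGroup.eq_one_iff _).mp this.symm

/-- Let `n = m + 1 ≥ 2`.  For `1 ≤ i ≤ n - 1 = m`, let `β_i : v ↦ B_i v + b_i` be the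
affine transformation of `ℝ^n`, where `B_i` is diagonal with `(i,i)` entry `1` and other
diagonal entries `-1`, and the `i`-th coordinate of `b_i` is `1/2`.  If
`Φ : G_{n-1} → Aff(ℝ^n)` is the homomorphism with `Φ(x_i) = β_i`, then `ker Φ` is a
free group. -/
theorem hw_affine_ker_free (m : ℕ) (hm : 1 ≤ m)
    (b : Fin m → Fin (m + 1) → ℝ) (hb : ∀ i : Fin m, b i i.castSucc = 1 / 2)
    (β : Fin m → ((Fin (m + 1) → ℝ) ≃ᵃ[ℝ] (Fin (m + 1) → ℝ)))
    (hβ : ∀ (i : Fin m) v (j : Fin (m + 1)),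
      β i v j = (if j = i.castSucc then v j else -v j) + b i j)
    (Φ : GHW m →* ((Fin (m + 1) → ℝ) ≃ᵃ[ℝ] (Fin (m + 1) → ℝ)))
    (hΦ : ∀ i : Fin m, Φ (ghw i) = β i) :
    IsFreeGroup ↥Φ.ker := by
  have hA : ∀ a ∈ hwA m, ∃ k : Fin m → Multiplicative ℤ, a = hwP m k ∧
      ∀ v (j : Fin m), Φ a v j.castSucc = v j.castSucc + ((k j).toAdd : ℝ) := by
    intro a ha
    unfold hwA at ha
    induction ha using Subgroup.closure_induction with
    | mem x hx =>
      obtain ⟨i, rfl⟩ := hx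
      refine ⟨Pi.mulSingle i (Multiplicative.ofAdd 1), ?_, ?_⟩
      · exact (hwP_single m i).symm
      · intro v j
        simp only [pow_two, map_mul, hΦ, AffineEquiv.mul_def, AffineEquiv.trans_apply, hβ]
        by_cases h : j = i
        · subst h; simp [hb]; ring
        · simp [h]
    | one => exact ⟨1, by simp, by simp⟩
    | mul x y _ _ hx hy =>
      obtain ⟨k, rfl, hk⟩ := hx
      obtain ⟨l, rfl, hl⟩ := hy
      refine ⟨k * l, by simp, ?_⟩
      intro v j
      rw [map_mul, AffineEquiv.mul_def, AffineEquiv.trans_apply, hk, hl]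
      simp; ring
    | inv x _ hx =>
      obtain ⟨k, rfl, hk⟩ := hx
      refine ⟨k⁻¹, by simp, ?_⟩
      intro v j
      have h := hk (Φ (hwP m k)⁻¹ v) j
      rw [← AffineEquiv.trans_apply, ← AffineEquiv.mul_def, ← map_mul] at h
      simp at h ⊢
      linarith
  have hKA : ∀ a ∈ hwA m, Φ a = 1 → a = 1 := by
    intro a ha h1
    obtain ⟨k, rfl, hk⟩ := hA a ha
    have : k = 1 := by
      funext j
      have := hk 0 j
      rw [h1] at this
      simpa using this.symm
    rw [this, map_one]
  have hR : ∀ g : GHW m, ∀ v w, Φ g v (Fin.last m) - Φ g w (Fin.last m) =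
      (((hwTheta m g).right : ℤ) : ℝ) * (v (Fin.last m) - w (Fin.last m)) := by
    intro g
    induction g using ghw_induction with
    | h1 => simp
    | hg i =>
      intro v w
      rw [hwTheta_ghw, hΦ, hβ, hβ]
      have : Fin.last m ≠ i.castSucc := (Fin.castSucc_lt_last i).ne'
      simp [this]; ring
    | hm a b ha hb =>
      intro v w
      simp only [map_mul, AffineEquiv.mul_def, AffineEquiv.trans_apply, ha, hb,
        SemidirectProduct.mul_right]
      push_cast; ring
    | hi a ha =>
      intro v w
      have h := ha (Φ a⁻¹ v) (Φ a⁻¹ w)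
      simp only [← AffineEquiv.trans_apply, ← AffineEquiv.mul_def, ← map_mul] at h
      simp only [map_inv, SemidirectProduct.inv_right]
      simp only [mul_inv_cancel, map_one, AffineEquiv.coe_one, id, map_inv] at h
      rw [h]
      rcases Int.units_eq_one_or (hwTheta m a).right with h | h <;> simp [h]
  have hK : ∀ g : Φ.ker, (hwTheta m g).right = 1 := by
    rintro ⟨g, hg⟩
    have h := hR g (fun _ => 1) (fun _ => 0)
    rw [MonoidHom.mem_ker.mp hg] at h
    rcases Int.units_eq_one_or (hwTheta m g).right with h' | h'
    · exact h'
    · rw [h'] at h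
      norm_num at h
  let f : Φ.ker →* FreeGroup (Fin m) :=
    { toFun := fun g => (hwTheta m g).left
      map_one' := by simp
      map_mul' := by
        intro x y
        simp [hK x] }
  have hf : Function.Injective f := by
    rw [injective_iff_map_eq_one]
    intro g hg
    have h1 : hwTheta m g = 1 := SemidirectProduct.ext hg (hK g)
    exact Subtype.ext (hKA g (hwTheta_ker m hm g h1) (MonoidHom.mem_ker.mp g.2))
  exact IsFreeGroup.ofMulEquiv (MonoidHom.ofInjective hf).symm
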